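/- arXiv:2208.01267 — 9 statements merged into one kernel-verified Lean document; each statement's English description precedes it below -/
import Mathlib

section
/- Let n ∈ ℝ³ be a unit vector and let β, v⁺, v⁻, w⁺, w⁻ ∈ ℝ³. Then ⟦β×v⟧_t · {{w}} − [v]_n {β·w} = −(β·n) ⟦v⟧_F · {{w}}, i.e. (n × (β × v⁺) − n × (β × v⁻)) · ((w⁺ + w⁻)/2) − (v⁺·n − v⁻·n)·((β·w⁺ + β·w⁻)/2) = −(β·n) (v⁺ − v⁻) · ((w⁺ + w⁻)/2). -/
open Matrix

/-- Identity involving the velocity field: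
`⟦β×v⟧_t · {{w}} − [v]_n {β·w} = −(β·n) ⟦v⟧_F · {{w}}`. -/
theorem beta_jump_identity (n β vp vm wp wm : Fin 3 → ℝ) (hn : n ⬝ᵥ n = 1) :
    (n ⨯₃ (β ⨯₃ vp) - n ⨯₃ (β ⨯₃ vm)) ⬝ᵥ ((wp + wm) / 2)
      - (vp ⬝ᵥ n - vm ⬝ᵥ n) * ((β ⬝ᵥ wp + β ⬝ᵥ wm) / 2) =
    -(β ⬝ᵥ n) * ((vp - vm) ⬝ᵥ ((wp + wm) / 2)) := by
  simp [crossProduct, dotProduct, Fin.sum_univ_three]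
  ring
end

section
/- Let n ∈ ℝ³ be a unit vector, let α⁺, α⁻ ∈ ℝ, and let β, v⁺, v⁻, w⁺, w⁻ ∈ ℝ³. Then [v]_n (⟦β·w⟧ · ⟦α⟧) + ⟦v⟧_t · (⟦β×w⟧_t × ⟦α⟧) = (β·⟦α⟧)(⟦v⟧_F · ⟦w⟧_F) − [α]_F β·(⟦v⟧_F [w]_n − ⟦w⟧_F [v]_n), where ⟦β·w⟧ := (β·w⁺ − β·w⁻)n and ⟦β×w⟧_t := n × (β×w⁺) − n × (β×w⁻). -/
open Matrix

/-- The identity in terms of the jumps, without normalising `n`. -/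
theorem alpha_aux (n : Fin 3 → ℝ) (a : ℝ) (β v w : Fin 3 → ℝ) :
    (v ⬝ᵥ n) * (((β ⬝ᵥ w) • n) ⬝ᵥ (a • n))
      + (n ⨯₃ v) ⬝ᵥ ((n ⨯₃ (β ⨯₃ w)) ⨯₃ (a • n)) =
    (n ⬝ᵥ n) * ((β ⬝ᵥ (a • n)) * (v ⬝ᵥ w)
      - a * (β ⬝ᵥ ((w ⬝ᵥ n) • v - (v ⬝ᵥ n) • w))) := by
  simp [cross_apply, dotProduct, Fin.sum_univ_three]
  ring

/-- Weight identity (3.1 of the paper):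
`[v]_n (⟦β·w⟧·⟦α⟧) + ⟦v⟧_t · (⟦β×w⟧_t × ⟦α⟧)
  = (β·⟦α⟧)(⟦v⟧_F·⟦w⟧_F) − [α]_F β·(⟦v⟧_F [w]_n − ⟦w⟧_F [v]_n)`. -/
theorem alpha_identity_one (n : Fin 3 → ℝ) (hn : n ⬝ᵥ n = 1)
    (αp αm : ℝ) (β vp vm wp wm : Fin 3 → ℝ) :
    (vp ⬝ᵥ n - vm ⬝ᵥ n) * (((β ⬝ᵥ wp - β ⬝ᵥ wm) • n) ⬝ᵥ ((αp - αm) • n))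
      + (n ⨯₃ vp - n ⨯₃ vm) ⬝ᵥ
          ((n ⨯₃ (β ⨯₃ wp) - n ⨯₃ (β ⨯₃ wm)) ⨯₃ ((αp - αm) • n)) =
    (β ⬝ᵥ ((αp - αm) • n)) * ((vp - vm) ⬝ᵥ (wp - wm))
      - (αp - αm) *
        (β ⬝ᵥ ((wp ⬝ᵥ n - wm ⬝ᵥ n) • (vp - vm) - (vp ⬝ᵥ n - vm ⬝ᵥ n) • (wp - wm))) := by
  have h := alpha_aux n (αp - αm) β (vp - vm) (wp - wm)
  rw [hn, one_mul] at h
  simp only [← sub_dotProduct, ← dotProduct_sub, ← map_sub]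
  exact h
end

section
/- Let n ∈ ℝ³ be a unit vector, let α⁺, α⁻ ∈ ℝ, and let β, v⁺, v⁻, w⁺, w⁻ ∈ ℝ³. Then ⟦β×v⟧_t · (⟦w⟧_t × ⟦α⟧) + ⟦v⟧_t · (⟦β×w⟧_t × ⟦α⟧) = −[α]_F β·(⟦v⟧_F [w]_n − ⟦w⟧_F [v]_n), where ⟦β×v⟧_t := n × (β×v⁺) − n × (β×v⁻) and ⟦β×w⟧_t := n × (β×w⁺) − n × (β×w⁻). -/
open Matrix

/-- Weight identity (3.2 of the paper):
`⟦β×v⟧_t · (⟦w⟧_t × ⟦α⟧) + ⟦v⟧_t · (⟦β×w⟧_t × ⟦α⟧)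
  = −[α]_F β·(⟦v⟧_F [w]_n − ⟦w⟧_F [v]_n)`. -/
theorem alpha_identity_two (n : Fin 3 → ℝ) (hn : n ⬝ᵥ n = 1)
    (αp αm : ℝ) (β vp vm wp wm : Fin 3 → ℝ) :
    (n ⨯₃ (β ⨯₃ vp) - n ⨯₃ (β ⨯₃ vm)) ⬝ᵥ ((n ⨯₃ wp - n ⨯₃ wm) ⨯₃ ((αp - αm) • n))
      + (n ⨯₃ vp - n ⨯₃ vm) ⬝ᵥ
          ((n ⨯₃ (β ⨯₃ wp) - n ⨯₃ (β ⨯₃ wm)) ⨯₃ ((αp - αm) • n)) =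
    -((αp - αm) *
        (β ⬝ᵥ ((wp ⬝ᵥ n - wm ⬝ᵥ n) • (vp - vm) - (vp ⬝ᵥ n - vm ⬝ᵥ n) • (wp - wm)))) := by
  simp only [cross_apply, dotProduct, Fin.sum_univ_three, Pi.sub_apply, Pi.smul_apply,
    smul_eq_mul, Matrix.cons_val] at hn ⊢
  linear_combination (-((αp - αm) *
    (β 0 * (((wp 0 * n 0 + wp 1 * n 1 + wp 2 * n 2) - (wm 0 * n 0 + wm 1 * n 1 + wm 2 * n 2))
        * (vp 0 - vm 0)
      - ((vp 0 * n 0 + vp 1 * n 1 + vp 2 * n 2) - (vm 0 * n 0 + vm 1 * n 1 + vm 2 * n 2))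
        * (wp 0 - wm 0))
    + β 1 * (((wp 0 * n 0 + wp 1 * n 1 + wp 2 * n 2) - (wm 0 * n 0 + wm 1 * n 1 + wm 2 * n 2))
        * (vp 1 - vm 1)
      - ((vp 0 * n 0 + vp 1 * n 1 + vp 2 * n 2) - (vm 0 * n 0 + vm 1 * n 1 + vm 2 * n 2))
        * (wp 1 - wm 1))
    + β 2 * (((wp 0 * n 0 + wp 1 * n 1 + wp 2 * n 2) - (wm 0 * n 0 + wm 1 * n 1 + wm 2 * n 2))
        * (vp 2 - vm 2)
      - ((vp 0 * n 0 + vp 1 * n 1 + vp 2 * n 2) - (vm 0 * n 0 + vm 1 * n 1 + vm 2 * n 2))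
        * (wp 2 - wm 2))))) * hn
end

section
/- Let n ∈ ℝ³ be a unit vector, let α⁺, α⁻ ∈ ℝ, and let β, v⁺, v⁻ ∈ ℝ³. Then the upwind stabilization identity [v]_n (⟦β·v⟧ · ⟦α⟧) + ⟦v⟧_t · (⟦β×v⟧_t × ⟦α⟧) = (β·⟦α⟧) ‖⟦v⟧_F‖² holds, where ⟦β·v⟧ := (β·v⁺ − β·v⁻)n, ⟦β×v⟧_t := n × (β×v⁺) − n × (β×v⁻), and ‖·‖ is the Euclidean norm. -/
open Matrix

/-- Upwind stabilization identity:
`[v]_n (⟦β·v⟧·⟦α⟧) + ⟦v⟧_t · (⟦β×v⟧_t × ⟦α⟧) = (β·⟦α⟧) ‖⟦v⟧_F‖²`. -/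
theorem upwind_stabilization (n : Fin 3 → ℝ) (hn : n ⬝ᵥ n = 1)
    (αp αm : ℝ) (β vp vm : Fin 3 → ℝ) :
    (vp ⬝ᵥ n - vm ⬝ᵥ n) * (((β ⬝ᵥ vp - β ⬝ᵥ vm) • n) ⬝ᵥ ((αp - αm) • n))
      + (n ⨯₃ vp - n ⨯₃ vm) ⬝ᵥ
          ((n ⨯₃ (β ⨯₃ vp) - n ⨯₃ (β ⨯₃ vm)) ⨯₃ ((αp - αm) • n)) =
    (β ⬝ᵥ ((αp - αm) • n)) * ((vp - vm) ⬝ᵥ (vp - vm)) := by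
  simp only [cross_apply, vec3_dotProduct, Pi.smul_apply, Pi.sub_apply, smul_eq_mul,
    Matrix.cons_val_zero, Matrix.cons_val_one, Matrix.cons_val] at hn ⊢
  linear_combination (αp - αm) * (β 0 * n 0 + β 1 * n 1 + β 2 * n 2) *
    ((vp 0 - vm 0) ^ 2 + (vp 1 - vm 1) ^ 2 + (vp 2 - vm 2) ^ 2) * hn
end

section
/- Let u, β : ℝ³ → ℝ³ be differentiable at a point x. Then the magnetic advection and its formal dual satisfy L_β u (x) + 𝓛_β u (x) = −(div β)(x) u(x) + (J_β(x) + J_β(x)ᵀ) u(x); explicitly, −β(x) × (curl u)(x) + grad(β·u)(x) + curl(β×u)(x) − (div u)(x) β(x) = −(div β)(x) u(x) + (J_β(x) + J_β(x)ᵀ) u(x). In particular, no derivative of u appears on the right-hand side. -/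
open Matrix

/-- `∂ᵢFⱼ(x)`: the `j`-th component of the Fréchet derivative of `F` at `x`
applied to the `i`-th standard basis vector. -/
noncomputable def pdv (F : (Fin 3 → ℝ) → (Fin 3 → ℝ)) (x : Fin 3 → ℝ) (i j : Fin 3) : ℝ :=
  fderiv ℝ F x (Pi.single i 1) j

/-- `∂ᵢf(x)` for a scalar function `f`. -/
noncomputable def pds (f : (Fin 3 → ℝ) → ℝ) (x : Fin 3 → ℝ) (i : Fin 3) : ℝ :=
  fderiv ℝ f x (Pi.single i 1)

/-- `curl F(x) = (∂₂F₃ − ∂₃F₂, ∂₃F₁ − ∂₁F₃, ∂₁F₂ − ∂₂F₁)` (zero-based indices). -/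
noncomputable def curl3 (F : (Fin 3 → ℝ) → (Fin 3 → ℝ)) (x : Fin 3 → ℝ) : Fin 3 → ℝ :=
  ![pdv F x 1 2 - pdv F x 2 1, pdv F x 2 0 - pdv F x 0 2, pdv F x 0 1 - pdv F x 1 0]

/-- `div F(x) = ∂₁F₁ + ∂₂F₂ + ∂₃F₃`. -/
noncomputable def div3 (F : (Fin 3 → ℝ) → (Fin 3 → ℝ)) (x : Fin 3 → ℝ) : ℝ :=
  pdv F x 0 0 + pdv F x 1 1 + pdv F x 2 2

/-- `grad f(x) = (∂₁f, ∂₂f, ∂₃f)(x)`. -/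
noncomputable def grad3 (f : (Fin 3 → ℝ) → ℝ) (x : Fin 3 → ℝ) : Fin 3 → ℝ :=
  ![pds f x 0, pds f x 1, pds f x 2]

/-- The Jacobian matrix `(J_F(x))ᵢⱼ = ∂ⱼFᵢ(x)`. -/
noncomputable def jac3 (F : (Fin 3 → ℝ) → (Fin 3 → ℝ)) (x : Fin 3 → ℝ) :
    Matrix (Fin 3) (Fin 3) ℝ :=
  Matrix.of fun i j => pdv F x j i

/-- The magnetic (Lie) advection `L_β u := −β × (curl u) + grad(β·u)`. -/
noncomputable def Lie (β u : (Fin 3 → ℝ) → (Fin 3 → ℝ)) (x : Fin 3 → ℝ) : Fin 3 → ℝ :=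
  -(β x ⨯₃ curl3 u x) + grad3 (fun y => β y ⬝ᵥ u y) x

/-- The formal dual of the magnetic advection `𝓛_β v := curl(β×v) − (div v)·β`. -/
noncomputable def LieDual (β v : (Fin 3 → ℝ) → (Fin 3 → ℝ)) (x : Fin 3 → ℝ) : Fin 3 → ℝ :=
  curl3 (fun y => β y ⨯₃ v y) x - div3 v x • β x

theorem pdv_of_comp (F : (Fin 3 → ℝ) → (Fin 3 → ℝ)) (x : Fin 3 → ℝ) (i j : Fin 3)
    (hF : DifferentiableAt ℝ F x) : pdv F x i j = pds (fun y => F y j) x i := by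
  have h := (hasFDerivAt_pi'.1 hF.hasFDerivAt) j
  unfold pdv pds
  rw [h.fderiv]
  rfl

theorem pds_mul_comp (F G : (Fin 3 → ℝ) → (Fin 3 → ℝ)) (x : Fin 3 → ℝ) (a b : Fin 3)
    (hF : DifferentiableAt ℝ F x) (hG : DifferentiableAt ℝ G x) :
    HasFDerivAt (fun y => F y a * G y b)
      (F x a • fderiv ℝ (fun y => G y b) x + G x b • fderiv ℝ (fun y => F y a) x) x := by
  have h1 : DifferentiableAt ℝ (fun y => F y a) x := differentiableAt_pi.1 hF a
  have h2 : DifferentiableAt ℝ (fun y => G y b) x := differentiableAt_pi.1 hG b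
  exact h1.hasFDerivAt.mul h2.hasFDerivAt

theorem pds_dot (β u : (Fin 3 → ℝ) → (Fin 3 → ℝ)) (x : Fin 3 → ℝ) (i : Fin 3)
    (hu : DifferentiableAt ℝ u x) (hβ : DifferentiableAt ℝ β x) :
    pds (fun y => β y ⬝ᵥ u y) x i =
      (β x 0 * pdv u x i 0 + u x 0 * pdv β x i 0) + (β x 1 * pdv u x i 1 + u x 1 * pdv β x i 1)
      + (β x 2 * pdv u x i 2 + u x 2 * pdv β x i 2) := by
  have h := ((pds_mul_comp β u x 0 0 hβ hu).add (pds_mul_comp β u x 1 1 hβ hu)).add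
    (pds_mul_comp β u x 2 2 hβ hu)
  have e : (fun y => β y ⬝ᵥ u y) = fun y => β y 0 * u y 0 + β y 1 * u y 1 + β y 2 * u y 2 := by
    funext y
    simp [dotProduct, Fin.sum_univ_three]
  simp only [pdv_of_comp _ _ _ _ hu, pdv_of_comp _ _ _ _ hβ]
  rw [e]
  unfold pds
  erw [h.fderiv]
  simp

theorem pds_sub_mul (β u : (Fin 3 → ℝ) → (Fin 3 → ℝ)) (x : Fin 3 → ℝ) (i a b : Fin 3)
    (hu : DifferentiableAt ℝ u x) (hβ : DifferentiableAt ℝ β x) :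
    pds (fun y => β y a * u y b - β y b * u y a) x i =
      (β x a * pdv u x i b + u x b * pdv β x i a)
      - (β x b * pdv u x i a + u x a * pdv β x i b) := by
  have h := (pds_mul_comp β u x a b hβ hu).sub (pds_mul_comp β u x b a hβ hu)
  simp only [pdv_of_comp _ _ _ _ hu, pdv_of_comp _ _ _ _ hβ]
  unfold pds
  erw [h.fderiv]
  simp

theorem differentiableAt_cross (β u : (Fin 3 → ℝ) → (Fin 3 → ℝ)) (x : Fin 3 → ℝ)
    (hu : DifferentiableAt ℝ u x) (hβ : DifferentiableAt ℝ β x) :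
    DifferentiableAt ℝ (fun y => β y ⨯₃ u y) x := by
  rw [differentiableAt_pi]
  intro i
  have h := fun a b => ((pds_mul_comp β u x a b hβ hu).sub
    (pds_mul_comp β u x b a hβ hu)).differentiableAt
  fin_cases i
  · simp only [cross_apply]; exact h 1 2
  · simp only [cross_apply]; exact h 2 0
  · simp only [cross_apply]; exact h 0 1

/-- The sum of the magnetic advection and its formal dual contains no derivative of `u`:
`L_β u + 𝓛_β u = −(div β) u + (J_β + J_βᵀ) u`. -/
theorem lie_add_dual (u β : (Fin 3 → ℝ) → (Fin 3 → ℝ)) (x : Fin 3 → ℝ)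
    (hu : DifferentiableAt ℝ u x) (hβ : DifferentiableAt ℝ β x) :
    Lie β u x + LieDual β u x =
      -(div3 β x) • u x + (jac3 β x + (jac3 β x)ᵀ).mulVec (u x) := by
  have hc := differentiableAt_cross β u x hu hβ
  have c0 : ∀ i, pdv (fun y => β y ⨯₃ u y) x i 0 =
      (β x 1 * pdv u x i 2 + u x 2 * pdv β x i 1)
      - (β x 2 * pdv u x i 1 + u x 1 * pdv β x i 2) := by
    intro i
    rw [pdv_of_comp _ x i 0 hc, ← pds_sub_mul β u x i 1 2 hu hβ]
    simp [cross_apply]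
  have c1 : ∀ i, pdv (fun y => β y ⨯₃ u y) x i 1 =
      (β x 2 * pdv u x i 0 + u x 0 * pdv β x i 2)
      - (β x 0 * pdv u x i 2 + u x 2 * pdv β x i 0) := by
    intro i
    rw [pdv_of_comp _ x i 1 hc, ← pds_sub_mul β u x i 2 0 hu hβ]
    simp [cross_apply]
  have c2 : ∀ i, pdv (fun y => β y ⨯₃ u y) x i 2 =
      (β x 0 * pdv u x i 1 + u x 1 * pdv β x i 0)
      - (β x 1 * pdv u x i 0 + u x 0 * pdv β x i 1) := by
    intro i
    rw [pdv_of_comp _ x i 2 hc, ← pds_sub_mul β u x i 0 1 hu hβ]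
    simp [cross_apply]
  have d := fun i => pds_dot β u x i hu hβ
  simp only [Lie, LieDual, curl3, grad3, div3, jac3, c0, c1, c2, d]
  funext k
  fin_cases k <;>
  · simp [cross_apply, Matrix.mulVec, dotProduct, Fin.sum_univ_three, vecHead, vecTail]
    ring
end

section
/- Let u, v, β : ℝ³ → ℝ³ be differentiable at a point x. Then the pointwise duality identity (L_β u)(x) · v(x) − u(x) · (𝓛_β v)(x) = div((u·v)β)(x) holds, where (u·v)β denotes the vector field y ↦ (u(y)·v(y)) β(y) (which is differentiable at x). -/
open Matrix

theorem pds_mul' (f g : (Fin 3 → ℝ) → ℝ) (x : Fin 3 → ℝ) (i : Fin 3)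
    (hf : DifferentiableAt ℝ f x) (hg : DifferentiableAt ℝ g x) :
    pds (fun y => f y * g y) x i = f x * pds g x i + g x * pds f x i := by
  unfold pds
  rw [fderiv_fun_mul hf hg]
  simp

theorem pds_add' (f g : (Fin 3 → ℝ) → ℝ) (x : Fin 3 → ℝ) (i : Fin 3)
    (hf : DifferentiableAt ℝ f x) (hg : DifferentiableAt ℝ g x) :
    pds (fun y => f y + g y) x i = pds f x i + pds g x i := by
  unfold pds
  rw [fderiv_fun_add hf hg]
  simp

theorem pds_sub' (f g : (Fin 3 → ℝ) → ℝ) (x : Fin 3 → ℝ) (i : Fin 3)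
    (hf : DifferentiableAt ℝ f x) (hg : DifferentiableAt ℝ g x) :
    pds (fun y => f y - g y) x i = pds f x i - pds g x i := by
  unfold pds
  rw [fderiv_fun_sub hf hg]
  simp

/-- Pointwise duality identity: `(L_β u)·v − u·(𝓛_β v) = div((u·v)β)`. -/
theorem lie_duality_pointwise (u v β : (Fin 3 → ℝ) → (Fin 3 → ℝ)) (x : Fin 3 → ℝ)
    (hu : DifferentiableAt ℝ u x) (hv : DifferentiableAt ℝ v x)
    (hβ : DifferentiableAt ℝ β x) :
    Lie β u x ⬝ᵥ v x - u x ⬝ᵥ LieDual β v x =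
      div3 (fun y => (u y ⬝ᵥ v y) • β y) x := by
  have hu' := differentiableAt_pi.1 hu
  have hv' := differentiableAt_pi.1 hv
  have hb' := differentiableAt_pi.1 hβ
  have dot : ∀ (a b : (Fin 3 → ℝ) → (Fin 3 → ℝ)) (i : Fin 3),
      (∀ j, DifferentiableAt ℝ (fun y => a y j) x) →
      (∀ j, DifferentiableAt ℝ (fun y => b y j) x) →
      DifferentiableAt ℝ (fun y => a y ⬝ᵥ b y) x ∧
      pds (fun y => a y ⬝ᵥ b y) x i =
        (a x 0 * pds (fun y => b y 0) x i + b x 0 * pds (fun y => a y 0) x i) +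
        (a x 1 * pds (fun y => b y 1) x i + b x 1 * pds (fun y => a y 1) x i) +
        (a x 2 * pds (fun y => b y 2) x i + b x 2 * pds (fun y => a y 2) x i) := by
    intro a b i ha hb
    have m := fun j => (ha j).fun_mul (hb j)
    simp only [dotProduct, Fin.sum_univ_three]
    refine ⟨((m 0).fun_add (m 1)).fun_add (m 2), ?_⟩
    rw [pds_add' _ _ _ _ ((m 0).fun_add (m 1)) (m 2), pds_add' _ _ _ _ (m 0) (m 1),
      pds_mul' _ _ _ _ (ha 0) (hb 0), pds_mul' _ _ _ _ (ha 1) (hb 1),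
      pds_mul' _ _ _ _ (ha 2) (hb 2)]
  have cr : ∀ (i j k : Fin 3), pds (fun y => β y j * v y k - β y k * v y j) x i =
      (β x j * pds (fun y => v y k) x i + v x k * pds (fun y => β y j) x i) -
      (β x k * pds (fun y => v y j) x i + v x j * pds (fun y => β y k) x i) := by
    intro i j k
    rw [pds_sub' _ _ _ _ ((hb' j).fun_mul (hv' k)) ((hb' k).fun_mul (hv' j)),
      pds_mul' _ _ _ _ (hb' j) (hv' k), pds_mul' _ _ _ _ (hb' k) (hv' j)]
  have huv := (dot u v 0 hu' hv').1
  have hcross : DifferentiableAt ℝ (fun y => β y ⨯₃ v y) x := by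
    rw [differentiableAt_pi]
    intro j
    have m := fun j k => ((hb' j).fun_mul (hv' k)).fun_sub ((hb' k).fun_mul (hv' j))
    fin_cases j
    · simpa [cross_apply] using m 1 2
    · simpa [cross_apply] using m 2 0
    · simpa [cross_apply] using m 0 1
  have hdiv : ∀ i, pdv (fun y => (u y ⬝ᵥ v y) • β y) x i i =
      (u x ⬝ᵥ v x) * pds (fun y => β y i) x i + β x i * pds (fun y => u y ⬝ᵥ v y) x i := by
    intro i
    rw [pdv_of_comp _ _ _ _ (huv.fun_smul hβ)]
    exact pds_mul' _ _ _ _ huv (hb' i)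
  have c0 : ∀ i, pdv (fun y => β y ⨯₃ v y) x i 0 = _ := fun i =>
    (pdv_of_comp _ x i 0 hcross).trans (cr i 1 2)
  have c1 : ∀ i, pdv (fun y => β y ⨯₃ v y) x i 1 = _ := fun i =>
    (pdv_of_comp _ x i 1 hcross).trans (cr i 2 0)
  have c2 : ∀ i, pdv (fun y => β y ⨯₃ v y) x i 2 = _ := fun i =>
    (pdv_of_comp _ x i 2 hcross).trans (cr i 0 1)
  have pu := fun i j => pdv_of_comp u x i j hu
  have pv := fun i j => pdv_of_comp v x i j hv
  have d1 := fun i => (dot u v i hu' hv').2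
  have d2 := fun i => (dot β u i hb' hu').2
  unfold Lie LieDual div3 curl3 grad3
  simp only [hdiv, c0, c1, c2, pu, pv, d1, d2]
  simp [cross_apply, dotProduct, Fin.sum_univ_three]
  ring
end

section
/- Let a, b ∈ ℝ³ with aᵢ < bᵢ for i = 1,2,3, and let u, v, β : ℝ³ → ℝ³ be continuously differentiable on an open set containing the closed box D = [a₁,b₁]×[a₂,b₂]×[a₃,b₃]. Then ∫_D (L_β u) · v dx = ∫_D u · (𝓛_β v) dx + Σ_{i=1}^{3} ( ∫_{Fᵢ⁺} βᵢ (u·v) dS − ∫_{Fᵢ⁻} βᵢ (u·v) dS ), where Fᵢ⁺ (resp. Fᵢ⁻) is the face of D on which the i-th coordinate equals bᵢ (resp. aᵢ) and the face integrals are taken with respect to two-dimensional Lebesgue measure in the remaining coordinates; the boundary sum is precisely ∫_{∂D} (β·n)(u·v) with n the outward unit normal. -/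
open Matrix

open MeasureTheory

lemma aux_pdv_cont {F : (Fin 3 → ℝ) → (Fin 3 → ℝ)} {U : Set (Fin 3 → ℝ)} (hU : IsOpen U)
    (hF : ContDiffOn ℝ 1 F U) (i j : Fin 3) : ContinuousOn (fun x => pdv F x i j) U := by
  have h := hF.continuousOn_fderiv_of_isOpen hU le_rfl
  have h2 : ContinuousOn (fun x => fderiv ℝ F x (Pi.single i 1)) U :=
    h.clm_apply continuousOn_const
  exact (continuous_apply j).comp_continuousOn h2

lemma aux_pds_cont {f : (Fin 3 → ℝ) → ℝ} {U : Set (Fin 3 → ℝ)} (hU : IsOpen U)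
    (hF : ContDiffOn ℝ 1 f U) (i : Fin 3) : ContinuousOn (fun x => pds f x i) U := by
  have h := hF.continuousOn_fderiv_of_isOpen hU le_rfl
  exact h.clm_apply continuousOn_const

lemma aux_pdv_eq {F : (Fin 3 → ℝ) → (Fin 3 → ℝ)} {x : Fin 3 → ℝ}
    (hF : DifferentiableAt ℝ F x) (i j : Fin 3) : pdv F x i j = pds (fun y => F y j) x i := by
  unfold pdv pds
  rw [fderiv_apply hF]
  rfl

lemma aux_pds_mul {f g : (Fin 3 → ℝ) → ℝ} {x : Fin 3 → ℝ}
    (hf : DifferentiableAt ℝ f x) (hg : DifferentiableAt ℝ g x) (i : Fin 3) :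
    pds (fun y => f y * g y) x i = f x * pds g x i + g x * pds f x i := by
  unfold pds
  rw [fderiv_fun_mul hf hg]
  rfl

lemma aux_pds_add {f g : (Fin 3 → ℝ) → ℝ} {x : Fin 3 → ℝ}
    (hf : DifferentiableAt ℝ f x) (hg : DifferentiableAt ℝ g x) (i : Fin 3) :
    pds (fun y => f y + g y) x i = pds f x i + pds g x i := by
  unfold pds
  rw [fderiv_fun_add hf hg]
  rfl

lemma aux_pds_sub {f g : (Fin 3 → ℝ) → ℝ} {x : Fin 3 → ℝ}
    (hf : DifferentiableAt ℝ f x) (hg : DifferentiableAt ℝ g x) (i : Fin 3) :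
    pds (fun y => f y - g y) x i = pds f x i - pds g x i := by
  unfold pds
  rw [fderiv_fun_sub hf hg]
  rfl

lemma aux_dot {f g : (Fin 3 → ℝ) → (Fin 3 → ℝ)} {x : Fin 3 → ℝ}
    (hf : ∀ j, DifferentiableAt ℝ (fun y => f y j) x)
    (hg : ∀ j, DifferentiableAt ℝ (fun y => g y j) x) (i : Fin 3) :
    pds (fun y => f y ⬝ᵥ g y) x i =
      (f x 0 * pds (fun y => g y 0) x i + g x 0 * pds (fun y => f y 0) x i) +
      (f x 1 * pds (fun y => g y 1) x i + g x 1 * pds (fun y => f y 1) x i) +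
      (f x 2 * pds (fun y => g y 2) x i + g x 2 * pds (fun y => f y 2) x i) := by
  simp only [dotProduct, Fin.sum_univ_three]
  rw [aux_pds_add (((hf 0).fun_mul (hg 0)).fun_add ((hf 1).fun_mul (hg 1))) ((hf 2).fun_mul (hg 2)),
    aux_pds_add ((hf 0).fun_mul (hg 0)) ((hf 1).fun_mul (hg 1)),
    aux_pds_mul (hf 0) (hg 0), aux_pds_mul (hf 1) (hg 1), aux_pds_mul (hf 2) (hg 2)]

lemma aux_det {f g : (Fin 3 → ℝ) → (Fin 3 → ℝ)} {x : Fin 3 → ℝ}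
    (hf : ∀ j, DifferentiableAt ℝ (fun y => f y j) x)
    (hg : ∀ j, DifferentiableAt ℝ (fun y => g y j) x) (i j k : Fin 3) :
    pds (fun y => f y j * g y k - f y k * g y j) x i =
      (f x j * pds (fun y => g y k) x i + g x k * pds (fun y => f y j) x i) -
      (f x k * pds (fun y => g y j) x i + g x j * pds (fun y => f y k) x i) := by
  rw [aux_pds_sub ((hf j).fun_mul (hg k)) ((hf k).fun_mul (hg j)),
    aux_pds_mul (hf j) (hg k), aux_pds_mul (hf k) (hg j)]

lemma aux_cross_contDiff {f g : (Fin 3 → ℝ) → (Fin 3 → ℝ)} {U : Set (Fin 3 → ℝ)}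
    (hf : ContDiffOn ℝ 1 f U) (hg : ContDiffOn ℝ 1 g U) :
    ContDiffOn ℝ 1 (fun y => f y ⨯₃ g y) U := by
  rw [contDiffOn_pi] at hf hg ⊢
  intro i
  fin_cases i <;> simp [cross_apply]
  · exact ((hf 1).mul (hg 2)).sub ((hf 2).mul (hg 1))
  · exact ((hf 2).mul (hg 0)).sub ((hf 0).mul (hg 2))
  · exact ((hf 0).mul (hg 1)).sub ((hf 1).mul (hg 0))

lemma aux_dot_contDiff {f g : (Fin 3 → ℝ) → (Fin 3 → ℝ)} {U : Set (Fin 3 → ℝ)}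
    (hf : ContDiffOn ℝ 1 f U) (hg : ContDiffOn ℝ 1 g U) :
    ContDiffOn ℝ 1 (fun y => f y ⬝ᵥ g y) U := by
  rw [contDiffOn_pi] at hf hg
  simp only [dotProduct, Fin.sum_univ_three]
  exact (((hf 0).mul (hg 0)).add ((hf 1).mul (hg 1))).add ((hf 2).mul (hg 2))

lemma aux_pointwise {u v β : (Fin 3 → ℝ) → (Fin 3 → ℝ)} {x : Fin 3 → ℝ}
    (hu : DifferentiableAt ℝ u x) (hv : DifferentiableAt ℝ v x) (hβ : DifferentiableAt ℝ β x)
    (hc : DifferentiableAt ℝ (fun y => β y ⨯₃ v y) x) :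
    Lie β u x ⬝ᵥ v x = u x ⬝ᵥ LieDual β v x
      + ∑ i, pds (fun y => β y i * (u y ⬝ᵥ v y)) x i := by
  have hu' := fun j => differentiableAt_pi.1 hu j
  have hv' := fun j => differentiableAt_pi.1 hv j
  have hβ' := fun j => differentiableAt_pi.1 hβ j
  have hd : DifferentiableAt ℝ (fun y => u y ⬝ᵥ v y) x := by
    simp only [dotProduct, Fin.sum_univ_three]
    exact (((hu' 0).mul (hv' 0)).add ((hu' 1).mul (hv' 1))).add ((hu' 2).mul (hv' 2))
  have c0 : (fun y => (β y ⨯₃ v y) 0) = fun y => β y 1 * v y 2 - β y 2 * v y 1 := by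
    funext y; simp [cross_apply]
  have c1 : (fun y => (β y ⨯₃ v y) 1) = fun y => β y 2 * v y 0 - β y 0 * v y 2 := by
    funext y; simp [cross_apply]
  have c2 : (fun y => (β y ⨯₃ v y) 2) = fun y => β y 0 * v y 1 - β y 1 * v y 0 := by
    funext y; simp [cross_apply]
  have key : ∀ i, pds (fun y => β y i * (u y ⬝ᵥ v y)) x i =
      β x i * pds (fun y => u y ⬝ᵥ v y) x i + (u x ⬝ᵥ v x) * pds (fun y => β y i) x i :=
    fun i => aux_pds_mul (hβ' i) hd i
  simp only [key, Fin.sum_univ_three, aux_dot hu' hv']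
  simp only [Lie, LieDual, curl3, div3, grad3, aux_pdv_eq hu, aux_pdv_eq hv, aux_pdv_eq hc,
    c0, c1, c2, aux_det hβ' hv', aux_dot hβ' hu']
  simp [dotProduct, Fin.sum_univ_three, cross_apply]
  ring

lemma aux_face (g : (Fin 2 → ℝ) → ℝ) (a b : Fin 2 → ℝ) :
    ∫ x in Set.Icc a b, g x = ∫ p in Set.Icc (a 0, a 1) (b 0, b 1), g ![p.1, p.2] := by
  have h := (volume_preserving_finTwoArrow ℝ).symm
  rw [← h.setIntegral_preimage_emb (MeasurableEquiv.measurableEmbedding _)]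
  have : (MeasurableEquiv.finTwoArrow (α := ℝ)).symm ⁻¹' Set.Icc a b
      = Set.Icc (a 0, a 1) (b 0, b 1) := by
    ext p
    simp [MeasurableEquiv.finTwoArrow, Pi.le_def, Fin.forall_fin_two, Prod.le_def]
  rw [this]
  rfl


/-- Integration by parts for the magnetic advection over a box `D = [a₁,b₁]×[a₂,b₂]×[a₃,b₃]`:
`∫_D (L_β u)·v = ∫_D u·(𝓛_β v) + Σᵢ (∫_{Fᵢ⁺} βᵢ(u·v) − ∫_{Fᵢ⁻} βᵢ(u·v))`,
the boundary sum being `∫_{∂D} (β·n)(u·v)` with outward unit normal `n`. -/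
theorem lie_integration_by_parts_box (a₁ a₂ a₃ b₁ b₂ b₃ : ℝ)
    (h₁ : a₁ < b₁) (h₂ : a₂ < b₂) (h₃ : a₃ < b₃)
    (u v β : (Fin 3 → ℝ) → (Fin 3 → ℝ)) (U : Set (Fin 3 → ℝ)) (hU : IsOpen U)
    (hDU : Set.Icc ![a₁, a₂, a₃] ![b₁, b₂, b₃] ⊆ U)
    (hu : ContDiffOn ℝ 1 u U) (hv : ContDiffOn ℝ 1 v U) (hβ : ContDiffOn ℝ 1 β U) :
    ∫ x in Set.Icc ![a₁, a₂, a₃] ![b₁, b₂, b₃], Lie β u x ⬝ᵥ v x =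
      (∫ x in Set.Icc ![a₁, a₂, a₃] ![b₁, b₂, b₃], u x ⬝ᵥ LieDual β v x)
      + (((∫ p in Set.Icc (a₂, a₃) (b₂, b₃),
            β ![b₁, p.1, p.2] 0 * (u ![b₁, p.1, p.2] ⬝ᵥ v ![b₁, p.1, p.2]))
          - ∫ p in Set.Icc (a₂, a₃) (b₂, b₃),
            β ![a₁, p.1, p.2] 0 * (u ![a₁, p.1, p.2] ⬝ᵥ v ![a₁, p.1, p.2]))
        + ((∫ p in Set.Icc (a₁, a₃) (b₁, b₃),
            β ![p.1, b₂, p.2] 1 * (u ![p.1, b₂, p.2] ⬝ᵥ v ![p.1, b₂, p.2]))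
          - ∫ p in Set.Icc (a₁, a₃) (b₁, b₃),
            β ![p.1, a₂, p.2] 1 * (u ![p.1, a₂, p.2] ⬝ᵥ v ![p.1, a₂, p.2]))
        + ((∫ p in Set.Icc (a₁, a₂) (b₁, b₂),
            β ![p.1, p.2, b₃] 2 * (u ![p.1, p.2, b₃] ⬝ᵥ v ![p.1, p.2, b₃]))
          - ∫ p in Set.Icc (a₁, a₂) (b₁, b₂),
            β ![p.1, p.2, a₃] 2 * (u ![p.1, p.2, a₃] ⬝ᵥ v ![p.1, p.2, a₃]))) := by
  have hle : (![a₁, a₂, a₃] : Fin 3 → ℝ) ≤ ![b₁, b₂, b₃] := by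
    intro i; fin_cases i <;> simp [h₁.le, h₂.le, h₃.le]
  have hat : ∀ {F : (Fin 3 → ℝ) → (Fin 3 → ℝ)}, ContDiffOn ℝ 1 F U → ∀ x ∈ U,
      DifferentiableAt ℝ F x := fun hF x hx =>
    (hF.contDiffAt (hU.mem_nhds hx)).differentiableAt one_ne_zero
  have hcr := aux_cross_contDiff hβ hv
  have hbu := aux_dot_contDiff hβ hu
  have huv := aux_dot_contDiff hu hv
  have hf : ∀ i, ContDiffOn ℝ 1 (fun y => β y i * (u y ⬝ᵥ v y)) U := fun i =>
    (contDiffOn_pi.1 hβ i).mul huv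
  have hcomp : IsCompact (Set.Icc (![a₁, a₂, a₃] : Fin 3 → ℝ) ![b₁, b₂, b₃]) := isCompact_Icc
  have hdivc : ContinuousOn (fun x => ∑ i, pds (fun y => β y i * (u y ⬝ᵥ v y)) x i) U :=
    continuousOn_finsetSum _ fun i _ => aux_pds_cont hU (hf i) i
  have hdivi := (hdivc.mono hDU).integrableOn_compact (μ := volume) hcomp
  have hu0 := fun i => (contDiffOn_pi.1 hu i).continuousOn
  have hβ0 := fun i => (contDiffOn_pi.1 hβ i).continuousOn
  have hdual : ContinuousOn (fun x => u x ⬝ᵥ LieDual β v x) U := by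
    have e := fun i j => aux_pdv_cont hU hcr i j
    have e2 := fun i j => aux_pdv_cont hU hv i j
    have hdiv : ContinuousOn (fun x => div3 v x) U := ((e2 0 0).add (e2 1 1)).add (e2 2 2)
    simp only [dotProduct, Fin.sum_univ_three, LieDual, curl3, Pi.sub_apply, Pi.smul_apply,
      smul_eq_mul]
    refine (((hu0 0).mul (((e 1 2).sub (e 2 1)).sub (hdiv.mul (hβ0 0)))).add
      ((hu0 1).mul (((e 2 0).sub (e 0 2)).sub (hdiv.mul (hβ0 1))))).add
      ((hu0 2).mul (((e 0 1).sub (e 1 0)).sub (hdiv.mul (hβ0 2))))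
  have hduali := (hdual.mono hDU).integrableOn_compact (μ := volume) hcomp
  have hdivthm := integral_divergence_of_hasFDerivAt_off_countable' ![a₁, a₂, a₃] ![b₁, b₂, b₃]
    hle (fun i y => β y i * (u y ⬝ᵥ v y)) (fun i x => fderiv ℝ (fun y => β y i * (u y ⬝ᵥ v y)) x)
    ∅ Set.countable_empty (fun i => ((hf i).continuousOn).mono hDU)
    (fun x hx i => (((hf i).contDiffAt (hU.mem_nhds (hDU (by
      have h := hx.1
      rw [← Set.pi_univ_Icc]
      exact Set.pi_mono (fun i _ => Set.Ioo_subset_Icc_self) h)))).differentiableAt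
        one_ne_zero).hasFDerivAt) hdivi
  rw [setIntegral_congr_fun measurableSet_Icc (fun x hx => aux_pointwise (hat hu x (hDU hx))
    (hat hv x (hDU hx)) (hat hβ x (hDU hx)) (hat hcr x (hDU hx))),
    integral_add hduali hdivi]
  congr 1
  refine hdivthm.trans ?_
  have i0 : ∀ c p q : ℝ, (Fin.insertNth (0 : Fin 3) c ![p, q] : Fin 3 → ℝ) = ![c, p, q] := by
    intro c p q; ext i; fin_cases i <;> rfl
  have i1 : ∀ c p q : ℝ, (Fin.insertNth (1 : Fin 3) c ![p, q] : Fin 3 → ℝ) = ![p, c, q] := by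
    intro c p q; ext i; fin_cases i <;> rfl
  have i2 : ∀ c p q : ℝ, (Fin.insertNth (2 : Fin 3) c ![p, q] : Fin 3 → ℝ) = ![p, q, c] := by
    intro c p q; ext i; fin_cases i <;> rfl
  rw [Fin.sum_univ_three]
  simp only [aux_face, i0, i1, i2]
  rfl
end

section
/- Let v, β : ℝ³ → ℝ³ and φ : ℝ³ → ℝ be differentiable at a point x. Then the formal dual of the magnetic advection satisfies the product rule 𝓛_β(φ v)(x) = φ(x) (𝓛_β v)(x) − (β(x) · grad φ(x)) v(x), where φv denotes the vector field y ↦ φ(y) v(y). -/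
open Matrix

theorem pdv_smul_aux (φ : (Fin 3 → ℝ) → ℝ) (w : (Fin 3 → ℝ) → (Fin 3 → ℝ)) (x : Fin 3 → ℝ)
    (hφ : DifferentiableAt ℝ φ x) (hw : DifferentiableAt ℝ w x) (i j : Fin 3) :
    pdv (fun y => φ y • w y) x i j = φ x * pdv w x i j + pds φ x i * w x j := by
  unfold pdv pds
  rw [fderiv_fun_smul hφ hw]
  simp

theorem cross_diff_aux (v β : (Fin 3 → ℝ) → (Fin 3 → ℝ)) (x : Fin 3 → ℝ)
    (hv : DifferentiableAt ℝ v x) (hβ : DifferentiableAt ℝ β x) :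
    DifferentiableAt ℝ (fun y => β y ⨯₃ v y) x := by
  have h1 := differentiableAt_pi.1 hv
  have h2 := differentiableAt_pi.1 hβ
  rw [differentiableAt_pi]
  intro i
  fin_cases i <;> simp only [cross_apply] <;>
    exact ((h2 _).mul (h1 _)).sub ((h2 _).mul (h1 _))

/-- Product rule for the formal dual of the magnetic advection:
`𝓛_β(φ v)(x) = φ(x) 𝓛_β v(x) − (β(x)·grad φ(x)) v(x)`. -/
theorem lie_dual_product_rule (v β : (Fin 3 → ℝ) → (Fin 3 → ℝ))
    (φ : (Fin 3 → ℝ) → ℝ) (x : Fin 3 → ℝ)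
    (hv : DifferentiableAt ℝ v x) (hβ : DifferentiableAt ℝ β x)
    (hφ : DifferentiableAt ℝ φ x) :
    LieDual β (fun y => φ y • v y) x =
      φ x • LieDual β v x - (β x ⬝ᵥ grad3 φ x) • v x := by
  have hc := cross_diff_aux v β x hv hβ
  have e : (fun y => β y ⨯₃ (φ y • v y)) = fun y => φ y • (β y ⨯₃ v y) := by
    funext y
    simp
  unfold LieDual
  rw [e]
  unfold curl3 div3 grad3
  simp only [pdv_smul_aux φ v x hφ hv, pdv_smul_aux φ _ x hφ hc]
  generalize pdv (fun y => β y ⨯₃ v y) x = P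
  funext i
  fin_cases i <;> simp [cross_apply, dotProduct, Fin.sum_univ_three, vecHead, vecTail] <;> ring
end

section
/- Let v, β : ℝ³ → ℝ³ be differentiable at a point x and let γ ∈ ℝ. Then the pointwise energy identity (L_β v)(x) · v(x) + γ ‖v(x)‖² = ( M(x) v(x) ) · v(x) + (1/2) div(‖v‖² β)(x) holds, where M(x) := (γ − (1/2) div β(x)) I + (1/2)(J_β(x) + J_β(x)ᵀ) is the effective reaction matrix and ‖v‖²β denotes the vector field y ↦ ‖v(y)‖² β(y). -/
open Matrix

theorem aux_hasFDerivAt_dot (u w : (Fin 3 → ℝ) → (Fin 3 → ℝ)) (x : Fin 3 → ℝ)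
    (hu : DifferentiableAt ℝ u x) (hw : DifferentiableAt ℝ w x) (i : Fin 3) :
    DifferentiableAt ℝ (fun y => u y ⬝ᵥ w y) x ∧
    fderiv ℝ (fun y => u y ⬝ᵥ w y) x (Pi.single i 1) =
      (u x 0 * pdv w x i 0 + w x 0 * pdv u x i 0) + (u x 1 * pdv w x i 1 + w x 1 * pdv u x i 1)
        + (u x 2 * pdv w x i 2 + w x 2 * pdv u x i 2) := by
  have hu' := hasFDerivAt_pi'.1 hu.hasFDerivAt
  have hw' := hasFDerivAt_pi'.1 hw.hasFDerivAt
  have h := (((hu' 0).mul (hw' 0)).add ((hu' 1).mul (hw' 1))).add ((hu' 2).mul (hw' 2))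
  have e : (fun y => u y ⬝ᵥ w y) = fun y => u y 0 * w y 0 + u y 1 * w y 1 + u y 2 * w y 2 := by
    funext y
    simp [dotProduct, Fin.sum_univ_three]
  rw [e]
  refine ⟨h.differentiableAt, ?_⟩
  have h2 := h.fderiv
  have h3 := congrArg (fun L => L (Pi.single i 1)) h2
  refine Eq.trans h3 ?_
  simp [pdv]

theorem lie_energy_identity (v β : (Fin 3 → ℝ) → (Fin 3 → ℝ)) (x : Fin 3 → ℝ) (γ : ℝ)
    (hv : DifferentiableAt ℝ v x) (hβ : DifferentiableAt ℝ β x) :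
    Lie β v x ⬝ᵥ v x + γ * (v x ⬝ᵥ v x) =
      (((γ - div3 β x / 2) • (1 : Matrix (Fin 3) (Fin 3) ℝ)
          + (1 / 2 : ℝ) • (jac3 β x + (jac3 β x)ᵀ)).mulVec (v x)) ⬝ᵥ v x
        + (1 / 2) * div3 (fun y => (v y ⬝ᵥ v y) • β y) x := by
  have hd : ∀ i j, pdv (fun y => (v y ⬝ᵥ v y) • β y) x i j =
      (v x ⬝ᵥ v x) * pdv β x i j + pds (fun y => v y ⬝ᵥ v y) x i * β x j := by
    intro i j
    have h := ((aux_hasFDerivAt_dot v v x hv hv i).1.hasFDerivAt.smul hβ.hasFDerivAt).fderiv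
    have h3 := congrFun (congrArg (fun L => L (Pi.single i 1)) h) j
    refine Eq.trans h3 ?_
    simp [pdv, pds]
  have hg : ∀ i, pds (fun y => v y ⬝ᵥ v y) x i = _ :=
    fun i => (aux_hasFDerivAt_dot v v x hv hv i).2
  have hg2 : ∀ i, pds (fun y => β y ⬝ᵥ v y) x i = _ :=
    fun i => (aux_hasFDerivAt_dot β v x hβ hv i).2
  simp only [Lie, div3, hd, grad3, hg, hg2, curl3, cross_apply]
  simp [dotProduct, Fin.sum_univ_three, Matrix.mulVec, jac3, Matrix.one_apply]
  ring
end
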